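/- Let q be odd, F/K a dihedral extension of degree 2q of number fields, L the subfield fixed by the rotation subgroup and k the subfield fixed by an order-2 subgroup. Then for every s ∈ ℂ with Re(s) > 1, the Dedekind zeta functions satisfy ζ_F(s)·ζ_K(s)² = ζ_L(s)·ζ_k(s)². -/

import Mathlib

open NumberField

/-- The Dedekind zeta function of a number field `K`, defined for `Re s > 1` by
the Dirichlet series `∑ 1/(N I)^s` over the nonzero integral ideals of `K`. -/
noncomputable def dedekindZetaFn (K : Type*) [Field K] [NumberField K] (s : ℂ) : ℂ :=
  ∑' I : {I : Ideal (𝓞 K) // I ≠ 0}, (Ideal.absNorm (I : Ideal (𝓞 K)) : ℂ) ^ (-s)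

/-- The `p`-adic valuation as an arithmetic function. -/
def padicValArith (p : ℕ) : ArithmeticFunction ℕ :=
  ⟨fun n ↦ n.factorization p, by simp⟩

theorem padicValArith_apply (p n : ℕ) : padicValArith p n = n.factorization p := rfl

theorem padicValArith_pmul_mul (p : ℕ) (f g : ArithmeticFunction ℕ) :
    (padicValArith p).pmul (f * g) =
      (padicValArith p).pmul f * g + f * (padicValArith p).pmul g := by
  ext n
  simp only [ArithmeticFunction.pmul_apply, ArithmeticFunction.mul_apply,
    ArithmeticFunction.add_apply, Finset.mul_sum, ← Finset.sum_add_distrib]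
  refine Finset.sum_congr rfl fun x hx ↦ ?_
  obtain ⟨h, hn⟩ := Nat.mem_divisorsAntidiagonal.1 hx
  have h1 : x.1 ≠ 0 := by rintro h0; simp [h0] at h; exact hn h.symm
  have h2 : x.2 ≠ 0 := by rintro h0; simp [h0] at h; exact hn h.symm
  simp only [padicValArith_apply, ← h, Nat.factorization_mul h1 h2, Finsupp.add_apply]
  ring

theorem padicValArith_pmul_mul_eq {p : ℕ} {f g T U : ArithmeticFunction ℕ}
    (hf : (padicValArith p).pmul f = T * f) (hg : (padicValArith p).pmul g = U * g) :
    (padicValArith p).pmul (f * g) = (T + U) * (f * g) := by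
  rw [padicValArith_pmul_mul, hf, hg]
  ring

/-- An arithmetic function is determined by its value at `1` and its logarithmic derivatives with
respect to all primes. -/
theorem ArithmeticFunction.eq_of_padicValArith_pmul_eq {f g : ArithmeticFunction ℕ}
    (h1 : f 1 = g 1)
    (h : ∀ p, p.Prime → ∃ T : ArithmeticFunction ℕ, T 1 = 0 ∧
      (padicValArith p).pmul f = T * f ∧ (padicValArith p).pmul g = T * g) : f = g := by
  ext n
  induction n using Nat.strong_induction_on with
  | _ n ih =>
    rcases eq_or_ne n 0 with rfl | hn0
    · simp
    rcases eq_or_ne n 1 with rfl | hn1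
    · exact h1
    obtain ⟨p, hp, hpn⟩ := Nat.exists_prime_and_dvd hn1
    have hv : n.factorization p ≠ 0 := (hp.factorization_pos_of_dvd hn0 hpn).ne'
    obtain ⟨T, hT, hf, hg⟩ := h p hp
    have hfn := congrArg (· n) hf
    have hgn := congrArg (· n) hg
    simp only [pmul_apply, padicValArith_apply] at hfn hgn
    refine Nat.eq_of_mul_eq_mul_left (Nat.pos_of_ne_zero hv) ?_
    rw [hfn, hgn, mul_apply, mul_apply]
    refine Finset.sum_congr rfl fun x hx ↦ ?_
    obtain ⟨h, -⟩ := Nat.mem_divisorsAntidiagonal.1 hx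
    rcases eq_or_ne x.1 1 with hx1 | hx1
    · simp [hx1, hT]
    · rw [ih x.2]
      have h1 : x.1 ≠ 0 := by rintro h0; simp [h0] at h; exact hn0 h.symm
      have h2 : x.2 ≠ 0 := by rintro h0; simp [h0] at h; exact hn0 h.symm
      rw [← h]
      exact lt_mul_left (Nat.pos_of_ne_zero h2) (by omega)

/-- The number of nonzero ideals of norm `n`, as an arithmetic function. -/
noncomputable def idealCount (R : Type*) [CommRing R] [IsDedekindDomain R] [Module.Free ℤ R] :
    ArithmeticFunction ℕ :=
  ⟨fun n ↦ if n = 0 then 0 else Nat.card {I : Ideal R // Ideal.absNorm I = n}, by simp⟩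

section idealCount

variable (R : Type*) [CommRing R] [IsDedekindDomain R] [Module.Free ℤ R]

theorem idealCount_apply {n : ℕ} (hn : n ≠ 0) :
    idealCount R n = Nat.card {I : Ideal R // Ideal.absNorm I = n} := if_neg hn

theorem idealCount_one [Module.Finite ℤ R] : idealCount R 1 = 1 := by
  simp [idealCount_apply, Ideal.absNorm_eq_one_iff]

end idealCount

section LSeries

variable (M : Type*) [Field M] [NumberField M]

open Filter Asymptotics in
theorem lseriesSummable_idealCount {s : ℂ} (hs : 1 < s.re) :
    LSeriesSummable (fun n ↦ (idealCount (𝓞 M) n : ℂ)) s := by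
  have key : (fun n : ℕ ↦ ∑ k ∈ Finset.Icc 1 n, (idealCount (𝓞 M) k : ℝ)) =O[atTop]
      fun n ↦ (n : ℝ) ^ (1 : ℝ) := by
    have h := (Ideal.tendsto_norm_le_div_atTop₀ M).comp tendsto_natCast_atTop_atTop
    have h2 := h.isBigO_one ℝ
    have h3 := h2.mul (isBigO_refl (fun n : ℕ ↦ (n : ℝ)) atTop)
    refine IsBigO.congr' h3 ?_ ?_
    · filter_upwards [eventually_ne_atTop 0] with n hn
      have hn' : (n : ℝ) ≠ 0 := by exact_mod_cast hn
      simp only [Function.comp_apply, Nat.cast_le]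
      rw [div_mul_cancel₀ _ hn', ← Nat.cast_sum]
      congr 1
      rw [← add_left_inj 1, ← Ideal.card_norm_le_eq_card_norm_le_add_one,
        show Finset.Icc 1 n = Finset.Ioc 0 n from Finset.Icc_succ_left_eq_Ioc _ _,
        Finset.sum_congr rfl (fun k hk ↦ idealCount_apply (𝓞 M) (Finset.mem_Ioc.1 hk).1.ne'),
        show 1 = Nat.card {I : Ideal (𝓞 M) // Ideal.absNorm I = 0} by
          simp [Ideal.absNorm_eq_zero_iff],
        Finset.sum_Ioc_add_eq_sum_Icc (n.zero_le),
        ← Finset.card_preimage_eq_sum_card_image_eq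
          (fun k _ ↦ Ideal.finite_setOfPred_absNorm_eq k)]
      simp [Set.coe_eq_subtype]
    · exact Eventually.of_forall fun n ↦ by simp
  simpa using LSeriesSummable_of_sum_norm_bigO_and_nonneg key (fun n ↦ Nat.cast_nonneg _)
    zero_le_one hs

theorem lseries_idealCount {s : ℂ} (hs : 1 < s.re) :
    LSeries (fun n ↦ (idealCount (𝓞 M) n : ℂ)) s = dedekindZetaFn M s := by
  set f : {I : Ideal (𝓞 M) // I ≠ 0} → ℂ := fun I ↦ (Ideal.absNorm (I : Ideal (𝓞 M)) : ℂ) ^ (-s)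
  set N : {I : Ideal (𝓞 M) // I ≠ 0} → ℕ := fun I ↦ Ideal.absNorm (I : Ideal (𝓞 M))
  have hN (I) : N I ≠ 0 := by simpa [N, Ideal.absNorm_eq_zero_iff] using I.2
  have hcard (n : ℕ) : Nat.card (N ⁻¹' {n}) = idealCount (𝓞 M) n := by
    rcases eq_or_ne n 0 with rfl | hn
    · simp [Set.eq_empty_of_forall_notMem (s := N ⁻¹' {0}) (fun I h ↦ hN I h)]
    · rw [idealCount_apply _ hn]
      refine Nat.card_congr ⟨fun I ↦ ⟨I.1.1, I.2⟩, fun I ↦ ⟨⟨I.1, ?_⟩, I.2⟩, fun _ ↦ rfl,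
        fun _ ↦ rfl⟩
      rintro h
      exact hn (by rw [← I.2, h]; simp)
  have hfin (n : ℕ) : Finite (N ⁻¹' {n}) := by
    refine Set.Finite.to_subtype (Set.Finite.preimage_embedding (f := Function.Embedding.subtype _)
      (s := {I | Ideal.absNorm I = n}) (Ideal.finite_setOfPred_absNorm_eq n))
  have hterm (n : ℕ) (z : ℂ) : LSeries.term (fun n ↦ (idealCount (𝓞 M) n : ℂ)) z n =
      idealCount (𝓞 M) n * (n : ℂ) ^ (-z) := by
    rcases eq_or_ne n 0 with rfl | hn
    · simp
    · rw [LSeries.term_of_ne_zero hn, Complex.cpow_neg, div_eq_mul_inv]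
  have hsum : Summable f := by
    refine Summable.of_norm ?_
    rw [← (Equiv.sigmaFiberEquiv N).summable_iff]
    have hfib (n : ℕ) (I : {I // N I = n}) : ‖f (Equiv.sigmaFiberEquiv N ⟨n, I⟩)‖ =
        ‖(n : ℂ) ^ (-s)‖ := by
      exact congrArg (fun m : ℕ ↦ ‖(m : ℂ) ^ (-s)‖) I.2
    refine (summable_sigma_of_nonneg fun x ↦ norm_nonneg (f (Equiv.sigmaFiberEquiv N x))).2
      ⟨fun n ↦ ?_, ?_⟩
    · have : Finite {I // N I = n} := hfin n
      exact Summable.of_finite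
    · refine (lseriesSummable_idealCount M hs).norm.congr fun n ↦ ?_
      rw [tsum_congr (hfib n), tsum_const, hterm, norm_mul,
        show Nat.card {I // N I = n} = idealCount (𝓞 M) n from hcard n]
      simp
  have h := hsum.hasSum.tsum_fiberwise N
  rw [dedekindZetaFn, ← h.tsum_eq, LSeries]
  refine tsum_congr fun n ↦ ?_
  have : ∀ I : N ⁻¹' {n}, f I = (n : ℂ) ^ (-s) := fun I ↦
    congrArg (fun m : ℕ ↦ (m : ℂ) ^ (-s)) I.2
  simp_rw [this, tsum_const, hcard, hterm]
  simp

end LSeries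

/-- A twisted form of Burnside's lemma: the points of `Y = X / G` fixed by a map `ψ` are counted
by the twisted fixed points on `X` of a lift `φ` of `ψ`. -/
theorem card_mul_card_fixedPoints_eq_sum {G X Y : Type*} [Group G] [Fintype G] [MulAction G X]
    [Finite X] {π : X → Y} (hπ : Function.Surjective π)
    (hG : ∀ x x', π x = π x' ↔ ∃ g : G, g • x = x') (φ : X → X) (ψ : Y → Y)
    (h : ∀ x, π (φ x) = ψ (π x)) :
    Nat.card G * Nat.card {y // ψ y = y} = ∑ g : G, Nat.card {x // g • x = φ x} := by
  classical
  have := Fintype.ofFinite X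
  have := Finite.of_surjective π hπ
  have := Fintype.ofFinite Y
  have key (x z z' : X) (hz : π x = π z) (hz' : π x = π z') :
      Finset.card {g : G | g • x = z} = Finset.card {g : G | g • x = z'} := by
    obtain ⟨a, rfl⟩ := (hG _ _).1 hz
    obtain ⟨b, rfl⟩ := (hG _ _).1 hz'
    refine Finset.card_equiv (Equiv.mulLeft (b * a⁻¹)) fun g ↦ ?_
    simp [mul_smul, inv_smul_eq_iff]
  have hfib (y : Y) : ∑ x with π x = y, Finset.card {g : G | g • x = φ x} =
      if ψ y = y then Fintype.card G else 0 := by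
    split_ifs with hy
    · obtain ⟨x₀, rfl⟩ := hπ y
      calc _ = ∑ x with π x = π x₀, Finset.card {g : G | g • x = x₀} :=
            Finset.sum_congr rfl fun x hx ↦ by
              have hx := (Finset.mem_filter.1 hx).2
              exact key x _ _ (by rw [h, hx, hy]) hx
        _ = ∑ x : X, Finset.card {g : G | g • x = x₀} := by
            refine Finset.sum_filter_of_ne fun x _ hx ↦ ?_
            obtain ⟨g, hg⟩ := Finset.card_ne_zero.1 hx
            exact (hG _ _).2 ⟨g, (Finset.mem_filter.1 hg).2⟩
        _ = ∑ g : G, Finset.card {x : X | g • x = x₀} :=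
            Finset.sum_card_bipartiteAbove_eq_sum_card_bipartiteBelow _
        _ = ∑ g : G, 1 := by
            refine Finset.sum_congr rfl fun g _ ↦ ?_
            rw [Finset.card_eq_one]
            exact ⟨g⁻¹ • x₀, by ext; simp [eq_inv_smul_iff]⟩
        _ = Fintype.card G := by simp
    · refine Finset.sum_eq_zero fun x hx ↦ ?_
      have hx := (Finset.mem_filter.1 hx).2
      rw [Finset.card_eq_zero, Finset.filter_eq_empty_iff]
      intro g _ hg
      apply hy
      rw [← hx, ← h]
      exact ((hG _ _).2 ⟨g, hg⟩).symm
  calc _ = ∑ y : Y, if ψ y = y then Fintype.card G else 0 := by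
        rw [← Finset.sum_filter, Finset.sum_const, smul_eq_mul, mul_comm, Nat.card_eq_fintype_card,
          Nat.card_eq_fintype_card, Fintype.card_subtype]
    _ = ∑ x : X, Finset.card {g : G | g • x = φ x} := by
        rw [← Finset.sum_congr rfl fun y _ ↦ hfib y]
        exact Finset.sum_fiberwise _ _ _
    _ = ∑ g : G, Finset.card {x : X | g • x = φ x} :=
        Finset.sum_card_bipartiteAbove_eq_sum_card_bipartiteBelow _
    _ = _ := by simp [Nat.card_eq_fintype_card, Fintype.card_subtype]

theorem Algebra.IsInvariant.exists_smul_eq_of_ringHom {A B G k : Type*} [CommRing A] [CommRing B]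
    [Algebra A B] [Group G] [Finite G] [MulSemiringAction G B] [SMulCommClass G A B]
    [Algebra.IsInvariant A B G] [CommRing k] [IsDomain k] (x y : B →+* k)
    (h : x.comp (algebraMap A B) = y.comp (algebraMap A B)) :
    ∃ g : G, ∀ b, y b = x (g • b) := by
  have := Fintype.ofFinite G
  have step (x y : B →+* k) (h : x.comp (algebraMap A B) = y.comp (algebraMap A B)) (b : B) :
      ∃ g : G, y b = x (g • b) := by
    obtain ⟨P, hP⟩ := Algebra.IsInvariant.charpoly_mem_lifts A B G b
    rw [Polynomial.coe_mapRingHom] at hP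
    have h0 : P.eval₂ (y.comp (algebraMap A B)) (y b) = 0 := by
      rw [← Polynomial.eval₂_map, hP, Polynomial.eval₂_at_apply, MulSemiringAction.eval_charpoly,
        map_zero]
    rw [← h, ← Polynomial.eval₂_map, hP, MulSemiringAction.charpoly_eq,
      Polynomial.eval₂_finsetProd, Finset.prod_eq_zero_iff] at h0
    obtain ⟨g, -, hg⟩ := h0
    exact ⟨g, by simpa [sub_eq_zero] using hg⟩
  have same (x y : B →+* k) (h : x.comp (algebraMap A B) = y.comp (algebraMap A B))
      (hker : RingHom.ker x = RingHom.ker y) : ∃ g : G, ∀ b, y b = x (g • b) := by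
    let Q := RingHom.ker x
    let P := Q.under A
    have : Q.IsPrime := RingHom.ker_isPrime x
    let f : B ⧸ Q →+* k := Ideal.Quotient.lift Q x fun a ha ↦ ha
    let f' : B ⧸ Q →+* k := Ideal.Quotient.lift Q y fun a ha ↦ by
      rwa [← RingHom.mem_ker, ← hker]
    have hf : Function.Injective f := RingHom.lift_injective_of_ker_le_ideal _ _ le_rfl
    have hf' : Function.Injective f' := RingHom.lift_injective_of_ker_le_ideal _ _ hker.ge
    have hrange : f'.range = f.range := by
      ext z
      simp only [RingHom.mem_range, Ideal.Quotient.mk_surjective.exists, f, f',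
        Ideal.Quotient.lift_mk]
      constructor
      · rintro ⟨b, rfl⟩
        obtain ⟨g, hg⟩ := step x y h b
        exact ⟨_, hg.symm⟩
      · rintro ⟨b, rfl⟩
        obtain ⟨g, hg⟩ := step y x h.symm b
        exact ⟨_, hg.symm⟩
    let e : B ⧸ Q ≃+* f.range := RingEquiv.ofBijective f.rangeRestrict
      ⟨fun a b hab ↦ hf (congrArg Subtype.val hab), f.rangeRestrict_surjective⟩
    let e' : B ⧸ Q ≃+* f'.range := RingEquiv.ofBijective f'.rangeRestrict
      ⟨fun a b hab ↦ hf' (congrArg Subtype.val hab), f'.rangeRestrict_surjective⟩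
    let τ : B ⧸ Q ≃+* B ⧸ Q := (e'.trans (RingEquiv.subringCongr hrange)).trans e.symm
    have hτ (b : B ⧸ Q) : f (τ b) = f' b :=
      congrArg Subtype.val (e.apply_symm_apply (RingEquiv.subringCongr hrange (e' b)))
    let τ' : (B ⧸ Q) ≃ₐ[A ⧸ P] (B ⧸ Q) := AlgEquiv.ofRingEquiv (f := τ) fun a ↦ by
      obtain ⟨a, rfl⟩ := Ideal.Quotient.mk_surjective a
      apply hf
      rw [hτ]
      exact (RingHom.congr_fun h a).symm
    obtain ⟨g, hg⟩ := Ideal.Quotient.stabilizerHom_surjective G P Q τ'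
    refine ⟨g, fun b ↦ ?_⟩
    have := hτ (Ideal.Quotient.mk Q b)
    rw [show τ (Ideal.Quotient.mk Q b) = Ideal.Quotient.mk Q (g • b) from
      congrArg (fun t ↦ t (Ideal.Quotient.mk Q b)) hg.symm] at this
    exact this.symm
  have := RingHom.ker_isPrime x
  have := RingHom.ker_isPrime y
  obtain ⟨g, hg⟩ := Algebra.IsInvariant.exists_smul_of_under_eq A B G
    (RingHom.ker x) (RingHom.ker y) (by
      ext a
      simpa [Ideal.mem_comap, RingHom.mem_ker] using by
        rw [show x (algebraMap A B a) = y (algebraMap A B a) from RingHom.congr_fun h a])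
  obtain ⟨g', hg'⟩ := same (x.comp (MulSemiringAction.toRingHom G B g⁻¹)) y
    (by rw [← h]; ext a; simp [smul_algebraMap]) (by
      ext b
      rw [hg, Ideal.mem_pointwise_smul_iff_inv_smul_mem]
      simp [RingHom.mem_ker])
  exact ⟨g⁻¹ * g', fun b ↦ by rw [hg', mul_smul]; rfl⟩

theorem exists_ringHom_comp_algebraMap_eq {A B k : Type*} [CommRing A] [CommRing B] [Algebra A B]
    [FaithfulSMul A B] [Algebra.IsIntegral A B] [Field k] [IsAlgClosed k] (y : A →+* k) :
    ∃ x : B →+* k, x.comp (algebraMap A B) = y := by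
  let P := RingHom.ker y
  have : P.IsPrime := RingHom.ker_isPrime y
  obtain ⟨Q, -, hQ, hQP⟩ := Ideal.exists_ideal_over_prime_of_isIntegral (S := B) P ⊥ (by
    rw [← RingHom.ker_eq_comap_bot,
      (RingHom.injective_iff_ker_eq_bot _).1 (FaithfulSMul.algebraMap_injective A B)]
    exact bot_le)
  have : Q.LiesOver P := ⟨hQP.symm⟩
  let f : A ⧸ P →+* k := Ideal.Quotient.lift P y fun a ha ↦ ha
  have hf : Function.Injective f := RingHom.lift_injective_of_ker_le_ideal _ _ le_rfl
  algebraize [f]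
  have : FaithfulSMul (A ⧸ P) k := (faithfulSMul_iff_algebraMap_injective _ _).2 hf
  have : Module.IsTorsionFree (A ⧸ P) (B ⧸ Q) :=
    .trans_faithfulSMul (A ⧸ P) (B ⧸ Q) (B ⧸ Q)
  have : Module.IsTorsionFree (A ⧸ P) k := .trans_faithfulSMul (A ⧸ P) k k
  let g : B ⧸ Q →ₐ[A ⧸ P] k := IsAlgClosed.lift
  refine ⟨(g : B ⧸ Q →+* k).comp (Ideal.Quotient.mk Q), ?_⟩
  ext a
  exact g.commutes (Ideal.Quotient.mk P a)

theorem card_mul_card_ringHom_pow_eq {A B G k : Type*} [CommRing A] [CommRing B]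
    [Algebra A B] [FaithfulSMul A B] [Group G] [Fintype G] [MulSemiringAction G B]
    [SMulCommClass G A B] [Algebra.IsInvariant A B G] [Field k] [IsAlgClosed k] [Finite (B →+* k)]
    (p : ℕ) [Fact p.Prime] [CharP k p] (m : ℕ) :
    Nat.card G * Nat.card {y : A →+* k // ∀ a, y a ^ p ^ m = y a} =
      ∑ g : G, Nat.card {x : B →+* k // ∀ b, x b ^ p ^ m = x (g • b)} := by
  have : Algebra.IsIntegral A B := Algebra.IsInvariant.isIntegral A B G
  let act : MulAction G (B →+* k) :=
    { smul g x := x.comp (MulSemiringAction.toRingHom G B g⁻¹)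
      one_smul x := by
        ext b
        change x ((1 : G)⁻¹ • b) = x b
        simp
      mul_smul g h x := by
        ext b
        change x ((g * h)⁻¹ • b) = x (h⁻¹ • g⁻¹ • b)
        rw [mul_inv_rev, mul_smul] }
  have hact (g : G) (x : B →+* k) (b : B) : (g • x) b = x (g⁻¹ • b) := rfl
  have key := card_mul_card_fixedPoints_eq_sum (G := G) (X := B →+* k) (Y := A →+* k)
    (π := fun x ↦ x.comp (algebraMap A B)) exists_ringHom_comp_algebraMap_eq
    (fun x x' ↦ ⟨fun h ↦ ?_, ?_⟩) (fun x ↦ (iterateFrobenius k p m).comp x)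
    (fun y ↦ (iterateFrobenius k p m).comp y) (fun x ↦ rfl)
  · simp only [RingHom.ext_iff, hact, RingHom.comp_apply, iterateFrobenius_def] at key
    rw [key, ← Equiv.sum_comp (Equiv.inv G)]
    simp only [Equiv.inv_apply, inv_inv, eq_comm]
  · obtain ⟨g, hg⟩ := Algebra.IsInvariant.exists_smul_eq_of_ringHom (G := G) x x' h
    exact ⟨g⁻¹, by ext b; rw [hact, inv_inv, hg]⟩
  · rintro ⟨g, rfl⟩
    ext a
    simp [hact, smul_algebraMap]

theorem card_ringHom_pow_eq_conj {B G k : Type*} [CommRing B] [Group G] [MulSemiringAction G B]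
    [Field k] (d : ℕ) (g h : G) :
    Nat.card {x : B →+* k // ∀ b, x b ^ d = x ((h * g * h⁻¹) • b)} =
      Nat.card {x : B →+* k // ∀ b, x b ^ d = x (g • b)} := by
  refine Nat.card_congr
    ⟨fun x ↦ ⟨x.1.comp (MulSemiringAction.toRingHom G B h), fun b ↦ ?_⟩,
     fun x ↦ ⟨x.1.comp (MulSemiringAction.toRingHom G B h⁻¹), fun b ↦ ?_⟩,
     fun x ↦ ?_, fun x ↦ ?_⟩
  · simpa [mul_smul] using x.2 (h • b)
  · simpa [mul_smul] using x.2 (h⁻¹ • b)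
  · ext b
    simp
  · ext b
    simp

section frobCount

open UniqueFactorizationMonoid

theorem finite_ringHom_of_finite_int (A k : Type*) [CommRing A] [Module.Finite ℤ A] [Field k] :
    Finite (A →+* k) :=
  Finite.of_equiv _ (RingHom.equivIntAlgHom A k).symm

open Classical in
/-- For every prime `p`, the function sending `p ^ m`, with `m ≥ 1`, to the number of ring
homomorphisms from `R` to the field with `p ^ m` elements, and all other integers to `0`. -/
noncomputable def frobCount (R : Type*) [CommRing R] (p : ℕ) [Fact p.Prime] :
    ArithmeticFunction ℕ :=
  ⟨fun n ↦ if ∃ m, m ≠ 0 ∧ n = p ^ m then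
    Nat.card {x : R →+* AlgebraicClosure (ZMod p) // ∀ r, x r ^ n = x r} else 0,
    if_neg fun ⟨m, _, h⟩ ↦ pow_ne_zero m (Fact.out : p.Prime).ne_zero h.symm⟩

theorem frobCount_pow (R : Type*) [CommRing R] (p : ℕ) [Fact p.Prime] {m : ℕ} (hm : m ≠ 0) :
    frobCount R p (p ^ m) =
      Nat.card {x : R →+* AlgebraicClosure (ZMod p) // ∀ r, x r ^ p ^ m = x r} :=
  if_pos ⟨m, hm, rfl⟩

theorem frobCount_eq_zero (R : Type*) [CommRing R] {p : ℕ} [Fact p.Prime] {n : ℕ}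
    (h : ¬ ∃ m, m ≠ 0 ∧ n = p ^ m) : frobCount R p n = 0 :=
  if_neg h

theorem frobCount_one (R : Type*) [CommRing R] (p : ℕ) [Fact p.Prime] : frobCount R p 1 = 0 :=
  frobCount_eq_zero R fun ⟨_, hm, h⟩ ↦
    (Nat.one_lt_pow hm (Fact.out : p.Prime).one_lt).ne h

open Classical in
/-- The finite set of primes of `R` containing the prime number `p`. -/
noncomputable def primesAbove (R : Type*) [CommRing R] [IsDedekindDomain R] (p : ℕ) :
    Finset (Ideal R) :=
  (normalizedFactors (Ideal.span {(p : R)})).toFinset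

variable {R : Type*} [CommRing R] [IsDedekindDomain R]

theorem mem_primesAbove [CharZero R] {p : ℕ} [NeZero p] {Q : Ideal R} :
    Q ∈ primesAbove R p ↔ Q.IsPrime ∧ (p : R) ∈ Q := by
  rw [primesAbove, Multiset.mem_toFinset, Ideal.mem_normalizedFactors_iff (by simp [NeZero.ne]),
    Ideal.span_singleton_le_iff_mem]

theorem ne_bot_of_mem_primesAbove [CharZero R] {p : ℕ} [NeZero p] {Q : Ideal R}
    (hQ : Q ∈ primesAbove R p) : Q ≠ ⊥ := by
  rintro rfl
  have := (mem_primesAbove.1 hQ).2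
  simp [NeZero.ne] at this

variable [Module.Free ℤ R] [Module.Finite ℤ R]

theorem card_filter_pow_dvd {I Q : Ideal R} (hI : I ≠ ⊥) (hQ : Prime Q)
    [DecidableEq (Ideal R)] [DecidablePred (Q ^ · ∣ I)] :
    Finset.card {j ∈ Finset.Icc 1 (Ideal.absNorm I) | Q ^ j ∣ I} =
      (normalizedFactors I).count Q := by
  have hdvd (j : ℕ) : Q ^ j ∣ I ↔ j ≤ (normalizedFactors I).count Q := by
    rw [pow_dvd_iff_le_emultiplicity, emultiplicity_eq_count_normalizedFactors hQ.irreducible hI,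
      normalize_eq, Nat.cast_le]
  have hle : (normalizedFactors I).count Q ≤ Ideal.absNorm I := by
    have h1 : Ideal.absNorm Q ≠ 0 := Ideal.absNorm_eq_zero_iff.not.2 hQ.ne_zero
    have h2 : Ideal.absNorm Q ≠ 1 := Ideal.absNorm_eq_one_iff.not.2
      (Ideal.isPrime_of_prime hQ).ne_top
    calc _ ≤ Ideal.absNorm Q ^ (normalizedFactors I).count Q :=
          (Nat.lt_pow_self (by omega)).le
      _ ≤ Ideal.absNorm I := by
          rw [← map_pow]
          exact Nat.le_of_dvd (Nat.pos_of_ne_zero (Ideal.absNorm_eq_zero_iff.not.2 hI))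
            (map_dvd _ ((hdvd _).2 le_rfl))
  rw [show ({j ∈ Finset.Icc 1 (Ideal.absNorm I) | Q ^ j ∣ I} : Finset ℕ) =
    Finset.Icc 1 ((normalizedFactors I).count Q) by ext j; simp [hdvd]; omega]
  simp

theorem card_absNorm_eq_and_dvd {A : Ideal R} (hA : A ≠ ⊥) {n : ℕ} (hn : n ≠ 0) :
    Nat.card {I : Ideal R // Ideal.absNorm I = n ∧ A ∣ I} =
      ∑ x ∈ n.divisorsAntidiagonal, if x.1 = Ideal.absNorm A then idealCount R x.2 else 0 := by
  have hA' : Ideal.absNorm A ≠ 0 := Ideal.absNorm_eq_zero_iff.not.2 hA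
  rw [Nat.sum_divisorsAntidiagonal
    (f := fun d e ↦ if d = Ideal.absNorm A then idealCount R e else 0),
    Finset.sum_ite_eq']
  split_ifs with h
  · obtain ⟨⟨e, he⟩, -⟩ := Nat.mem_divisors.1 h
    have he0 : e ≠ 0 := by rintro rfl; exact hn he
    rw [he, Nat.mul_div_cancel_left _ (Nat.pos_of_ne_zero hA'), idealCount_apply R he0]
    symm
    refine Nat.card_congr (Equiv.ofBijective (fun J ↦ ⟨A * J.1, ?_, dvd_mul_right _ _⟩) ⟨?_, ?_⟩)
    · rw [map_mul, J.2]
    · intro J J' h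
      exact Subtype.ext (mul_left_cancel₀ hA (congrArg Subtype.val h))
    · rintro ⟨_, hI, J, rfl⟩
      refine ⟨⟨J, ?_⟩, rfl⟩
      rw [map_mul] at hI
      exact Nat.eq_of_mul_eq_mul_left (Nat.pos_of_ne_zero hA') hI
  · rw [Nat.card_eq_zero]
    left
    exact ⟨fun ⟨I, hI, hAI⟩ ↦ h (Nat.mem_divisors.2 ⟨hI ▸ map_dvd _ hAI, hn⟩)⟩

variable [CharZero R] {p : ℕ} [Fact p.Prime]

theorem absNorm_eq_pow_of_mem_primesAbove {Q : Ideal R} (hQ : Q ∈ primesAbove R p) :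
    (Ideal.absNorm Q).factorization p ≠ 0 ∧
      Ideal.absNorm Q = p ^ (Ideal.absNorm Q).factorization p := by
  obtain ⟨hprime, hmem⟩ := mem_primesAbove.1 hQ
  have hmax := hprime.isMaximal (ne_bot_of_mem_primesAbove hQ)
  obtain ⟨q, n, hn, hq, hqp, h⟩ := Ideal.exists_prime_and_absNorm_eq_pow Q
  obtain rfl : q = p := by
    by_contra hne
    have hco : IsCoprime (q : ℤ) p :=
      Nat.isCoprime_iff_coprime.2 ((Nat.coprime_primes hqp Fact.out).2 hne)
    obtain ⟨a, b, hab⟩ := hco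
    refine hmax.ne_top ((Ideal.eq_top_iff_one _).2 ?_)
    have : ((a * q + b * p : ℤ) : R) ∈ Q := by
      push_cast
      exact Q.add_mem (Q.mul_mem_left _ hq) (Q.mul_mem_left _ hmem)
    rwa [hab, Int.cast_one] at this
  rw [h, hqp.factorization_pow]
  simpa using hn.ne'

theorem mem_primesAbove_of_factorization_ne_zero {Q : Ideal R} (hQ : Q.IsPrime)
    (h : (Ideal.absNorm Q).factorization p ≠ 0) : Q ∈ primesAbove R p := by
  have hbot : Q ≠ ⊥ := by rintro rfl; simp at h
  have hmax := hQ.isMaximal hbot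
  obtain ⟨q, n, hn, hq, hqp, hN⟩ := Ideal.exists_prime_and_absNorm_eq_pow Q
  rw [hN, hqp.factorization_pow, Finsupp.single_apply_ne_zero] at h
  exact mem_primesAbove.2 ⟨hQ, h.1 ▸ hq⟩

theorem card_ringHom_pow_eq_of_ker_eq {k : Type*} [Field k] [IsAlgClosed k] [CharP k p]
    {Q : Ideal R} (hQ : Q ∈ primesAbove R p) (m : ℕ) :
    Nat.card {x : R →+* k // RingHom.ker x = Q ∧ ∀ r, x r ^ p ^ m = x r} =
      if (Ideal.absNorm Q).factorization p ∣ m then (Ideal.absNorm Q).factorization p else 0 := by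
  obtain ⟨hf0, hN⟩ := absNorm_eq_pow_of_mem_primesAbove hQ
  have hbot := ne_bot_of_mem_primesAbove hQ
  have hprime := (mem_primesAbove.1 hQ).1
  have hmax := hprime.isMaximal hbot
  set f := (Ideal.absNorm Q).factorization p
  let _ : Field (R ⧸ Q) := Ideal.Quotient.field Q
  have hcard : Nat.card (R ⧸ Q) = p ^ f := by
    rw [← hN, Ideal.absNorm_apply, Submodule.cardQuot_apply]
  have : Finite (R ⧸ Q) := Nat.finite_of_card_ne_zero (by simp [hcard, NeZero.ne])
  have := Fintype.ofFinite (R ⧸ Q)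
  have : CharP (R ⧸ Q) p := (CharP.charP_iff_prime_eq_zero Fact.out).2 (by
    rw [← map_natCast (Ideal.Quotient.mk Q), Ideal.Quotient.eq_zero_iff_mem]
    exact (mem_primesAbove.1 hQ).2)
  let _ : Algebra (ZMod p) (R ⧸ Q) := ZMod.algebra _ p
  let _ : Algebra (ZMod p) k := ZMod.algebra _ p
  have hrank : Module.finrank (ZMod p) (R ⧸ Q) = f := by
    have := Module.natCard_eq_pow_finrank (K := ZMod p) (V := R ⧸ Q)
    rw [hcard, Nat.card_zmod] at this
    exact (Nat.pow_right_injective (Fact.out : p.Prime).two_le this).symm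
  have lift_inj {x : R →+* k} (hx : RingHom.ker x = Q) :
      Function.Injective (Ideal.Quotient.lift Q x fun a ha ↦ by
        rwa [← RingHom.mem_ker, hx]) := RingHom.lift_injective_of_ker_le_ideal _ _ hx.le
  split_ifs with hdvd
  · have hpow (z : R ⧸ Q) : z ^ p ^ m = z := by
      obtain ⟨c, rfl⟩ := hdvd
      rw [pow_mul, ← hcard, Nat.card_eq_fintype_card]
      exact FiniteField.pow_card_pow c z
    have hc := AlgHom.card (ZMod p) (R ⧸ Q) k
    rw [hrank, ← Nat.card_eq_fintype_card] at hc
    rw [← hc]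
    refine Nat.card_congr
      ⟨fun x ↦
        { Ideal.Quotient.lift Q x.1 fun a ha ↦ by rwa [← RingHom.mem_ker, x.2.1] with
          commutes' := RingHom.congr_fun (Subsingleton.elim
            ((Ideal.Quotient.lift Q x.1 fun a ha ↦ by rwa [← RingHom.mem_ker, x.2.1]).comp
              (algebraMap (ZMod p) (R ⧸ Q))) (algebraMap (ZMod p) k)) },
       fun g ↦ ⟨(g : R ⧸ Q →+* k).comp (Ideal.Quotient.mk Q), ?_, fun r ↦ ?_⟩,
       fun x ↦ ?_, fun g ↦ ?_⟩
    · rw [RingHom.ker_comp_of_injective _ (RingHom.injective _), Ideal.mk_ker]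
    · simp [← map_pow, hpow]
    · ext r
      rfl
    · ext z
      obtain ⟨r, rfl⟩ := Ideal.Quotient.mk_surjective z
      rfl
  · rw [Nat.card_eq_zero]
    left
    refine ⟨fun ⟨x, hx, hxm⟩ ↦ hdvd ?_⟩
    rw [← hrank, ← FiniteField.orderOf_frobeniusAlgHom (ZMod p) (R ⧸ Q)]
    refine orderOf_dvd_of_pow_eq_one (AlgHom.ext fun z ↦ lift_inj hx ?_)
    obtain ⟨r, rfl⟩ := Ideal.Quotient.mk_surjective z
    rw [AlgHom.coe_pow, FiniteField.coe_frobeniusAlgHom, pow_iterate, AlgHom.one_apply,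
      ZMod.card]
    change Ideal.Quotient.lift Q x _ (Ideal.Quotient.mk Q r ^ p ^ m) = _
    rw [← map_pow]
    simpa using hxm r

theorem frobCount_pow_eq_sum {m : ℕ} (hm : m ≠ 0) :
    frobCount R p (p ^ m) = ∑ Q ∈ primesAbove R p,
      if (Ideal.absNorm Q).factorization p ∣ m then (Ideal.absNorm Q).factorization p else 0 := by
  classical
  have := finite_ringHom_of_finite_int R (AlgebraicClosure (ZMod p))
  have := Fintype.ofFinite (R →+* AlgebraicClosure (ZMod p))
  rw [frobCount_pow R p hm, Nat.card_eq_fintype_card, Fintype.card_subtype,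
    Finset.card_eq_sum_card_fiberwise (f := RingHom.ker) (t := primesAbove R p)
      fun x _ ↦ mem_primesAbove.2 ⟨RingHom.ker_isPrime x, by simp [RingHom.mem_ker]⟩]
  refine Finset.sum_congr rfl fun Q hQ ↦ ?_
  rw [← card_ringHom_pow_eq_of_ker_eq (k := AlgebraicClosure (ZMod p)) hQ,
    Nat.card_eq_fintype_card, Fintype.card_subtype, Finset.filter_filter]
  simp only [and_comm]

theorem factorization_absNorm {I : Ideal R} (hI : I ≠ ⊥) [DecidableEq (Ideal R)] :
    (Ideal.absNorm I).factorization p = ∑ Q ∈ primesAbove R p,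
      (Ideal.absNorm Q).factorization p * (normalizedFactors I).count Q := by
  induction I using UniqueFactorizationMonoid.induction_on_prime with
  | h₁ => exact absurd rfl hI
  | h₂ I hu => simp [Ideal.isUnit_iff.1 hu, ← Ideal.one_eq_top]
  | h₃ J P hJ hP ih =>
    have hP' := Ideal.isPrime_of_prime hP
    rw [map_mul, Nat.factorization_mul (Ideal.absNorm_eq_zero_iff.not.2 hP.ne_zero)
      (Ideal.absNorm_eq_zero_iff.not.2 hJ), Finsupp.add_apply, ih hJ,
      normalizedFactors_mul hP.ne_zero hJ, normalizedFactors_irreducible hP.irreducible,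
      normalize_eq]
    simp only [Multiset.count_add, Multiset.count_singleton, mul_add, Finset.sum_add_distrib,
      mul_ite, mul_one, mul_zero, Finset.sum_ite_eq']
    split_ifs with h
    · rfl
    · rw [not_imp_comm.1 (mem_primesAbove_of_factorization_ne_zero hP') h]

theorem frobCount_eq_sum {n d : ℕ} (hn : n ≠ 0) (hd : d ∣ n) :
    frobCount R p d = ∑ Q ∈ primesAbove R p, ∑ j ∈ Finset.Icc 1 n,
      if d = Ideal.absNorm (Q ^ j) then (Ideal.absNorm Q).factorization p else 0 := by
  have hp : p.Prime := Fact.out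
  by_cases h : ∃ m, m ≠ 0 ∧ d = p ^ m
  · obtain ⟨m, hm, rfl⟩ := h
    rw [frobCount_pow_eq_sum hm]
    refine Finset.sum_congr rfl fun Q hQ ↦ ?_
    obtain ⟨hf0, hN⟩ := absNorm_eq_pow_of_mem_primesAbove hQ
    set f := (Ideal.absNorm Q).factorization p
    have hiff (j : ℕ) : p ^ m = Ideal.absNorm (Q ^ j) ↔ m = f * j := by
      rw [map_pow, hN, ← pow_mul, (Nat.pow_right_injective hp.two_le).eq_iff]
    simp_rw [hiff]
    split_ifs with hfm
    · obtain ⟨c, rfl⟩ := hfm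
      have hc : c ∈ Finset.Icc 1 n := by
        have hc0 : c ≠ 0 := right_ne_zero_of_mul hm
        refine Finset.mem_Icc.2 ⟨by omega, ?_⟩
        calc c ≤ f * c := Nat.le_mul_of_pos_left _ (Nat.pos_of_ne_zero hf0)
          _ ≤ p ^ (f * c) := (Nat.lt_pow_self hp.one_lt).le
          _ ≤ n := Nat.le_of_dvd (Nat.pos_of_ne_zero hn) hd
      simp [Nat.mul_right_inj hf0, hc]
    · exact (Finset.sum_eq_zero fun j _ ↦ if_neg fun h ↦ hfm ⟨j, h⟩).symm
  · rw [frobCount_eq_zero R h]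
    refine (Finset.sum_eq_zero fun Q hQ ↦ Finset.sum_eq_zero fun j hj ↦ if_neg fun hd ↦ h ?_).symm
    obtain ⟨hf0, hN⟩ := absNorm_eq_pow_of_mem_primesAbove hQ
    have hj0 : j ≠ 0 := by have := (Finset.mem_Icc.1 hj).1; omega
    exact ⟨_, mul_ne_zero hf0 hj0, by rw [hd, map_pow, hN, ← pow_mul]; simp [← hN]⟩

/-- The logarithmic derivative with respect to `p` of the Dirichlet series counting the ideals
of `R`. -/
theorem padicValArith_pmul_idealCount :
    (padicValArith p).pmul (idealCount R) = frobCount R p * idealCount R := by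
  classical
  ext n
  rcases eq_or_ne n 0 with rfl | hn
  · simp
  have hfin : Finite {I : Ideal R // Ideal.absNorm I = n} :=
    (Ideal.finite_setOfPred_absNorm_eq n).to_subtype
  have := Fintype.ofFinite {I : Ideal R // Ideal.absNorm I = n}
  have hbot (I : {I : Ideal R // Ideal.absNorm I = n}) : I.1 ≠ ⊥ :=
    fun h ↦ hn (by rw [← I.2, h, Ideal.absNorm_bot])
  have hprime {Q : Ideal R} (hQ : Q ∈ primesAbove R p) : Prime Q :=
    Ideal.prime_of_isPrime (ne_bot_of_mem_primesAbove hQ) (mem_primesAbove.1 hQ).1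
  calc n.factorization p * idealCount R n
      = ∑ I : {I : Ideal R // Ideal.absNorm I = n}, (Ideal.absNorm I.1).factorization p := by
        rw [Fintype.sum_congr (fun I : {I : Ideal R // Ideal.absNorm I = n} ↦
          (Ideal.absNorm I.1).factorization p) (fun _ ↦ n.factorization p) fun I ↦ by rw [I.2],
          Finset.sum_const, idealCount_apply R hn, Nat.card_eq_fintype_card, smul_eq_mul,
          mul_comm, Finset.card_univ]
    _ = ∑ I : {I : Ideal R // Ideal.absNorm I = n}, ∑ Q ∈ primesAbove R p,
          ∑ j ∈ Finset.Icc 1 n, if Q ^ j ∣ I.1 then (Ideal.absNorm Q).factorization p else 0 := by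
        refine Finset.sum_congr rfl fun I _ ↦ ?_
        rw [factorization_absNorm (hbot I)]
        refine Finset.sum_congr rfl fun Q hQ ↦ ?_
        rw [← card_filter_pow_dvd (hbot I) (hprime hQ), ← Finset.sum_filter, Finset.sum_const,
          smul_eq_mul, mul_comm, I.2]
    _ = ∑ Q ∈ primesAbove R p, ∑ j ∈ Finset.Icc 1 n, (Ideal.absNorm Q).factorization p *
          Nat.card {I : Ideal R // Ideal.absNorm I = n ∧ Q ^ j ∣ I} := by
        rw [Finset.sum_comm]
        refine Finset.sum_congr rfl fun Q _ ↦ ?_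
        rw [Finset.sum_comm]
        refine Finset.sum_congr rfl fun j _ ↦ ?_
        rw [← Finset.sum_filter, Finset.sum_const, smul_eq_mul, mul_comm, ← Fintype.card_subtype,
          ← Nat.card_eq_fintype_card]
        exact congrArg _ (Nat.card_congr (Equiv.subtypeSubtypeEquivSubtypeInter _ _))
    _ = ∑ x ∈ n.divisorsAntidiagonal, frobCount R p x.1 * idealCount R x.2 := by
        have h : ∀ x ∈ n.divisorsAntidiagonal, frobCount R p x.1 * idealCount R x.2 =
            (∑ Q ∈ primesAbove R p, ∑ j ∈ Finset.Icc 1 n,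
              if x.1 = Ideal.absNorm (Q ^ j) then (Ideal.absNorm Q).factorization p else 0) *
                idealCount R x.2 := fun x hx ↦ by
          rw [frobCount_eq_sum hn ⟨_, (Nat.mem_divisorsAntidiagonal.1 hx).1.symm⟩]
        rw [Finset.sum_congr rfl h]
        simp_rw [Finset.sum_mul]
        symm
        rw [Finset.sum_comm]
        refine Finset.sum_congr rfl fun Q hQ ↦ ?_
        rw [Finset.sum_comm]
        refine Finset.sum_congr rfl fun j _ ↦ ?_
        rw [card_absNorm_eq_and_dvd (pow_ne_zero j (hprime hQ).ne_zero) hn, Finset.mul_sum]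
        refine Finset.sum_congr rfl fun x _ ↦ ?_
        split_ifs <;> simp
    _ = (frobCount R p * idealCount R) n := by rw [ArithmeticFunction.mul_apply]

end frobCount

section dihedral

theorem card_mul_frobCount {A B G : Type*} [CommRing A] [CommRing B] [Module.Finite ℤ B]
    [Algebra A B] [FaithfulSMul A B] [Group G] [Fintype G] [MulSemiringAction G B]
    [IsGaloisGroup G A B] (p : ℕ) [Fact p.Prime] {m : ℕ} (hm : m ≠ 0) :
    Nat.card G * frobCount A p (p ^ m) =
      ∑ g : G, Nat.card {x : B →+* AlgebraicClosure (ZMod p) // ∀ b, x b ^ p ^ m = x (g • b)} := by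
  have := IsGaloisGroup.commutes (G := G) (A := A) (B := B)
  have := IsGaloisGroup.isInvariant (G := G) (A := A) (B := B)
  have := finite_ringHom_of_finite_int B (AlgebraicClosure (ZMod p))
  rw [frobCount_pow A p hm, card_mul_card_ringHom_pow_eq (B := B) (G := G)]

open DihedralGroup

theorem DihedralGroup.isConj_sr {q : ℕ} (hq : Odd q) (i j : ZMod q) : IsConj (sr i) (sr j) := by
  have h2 : IsUnit (2 : ZMod q) := by
    simpa using (ZMod.isUnit_iff_coprime 2 q).2 (Nat.coprime_two_left.2 hq)
  obtain ⟨t, ht⟩ := h2.dvd (a := i - j)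
  refine isConj_iff.2 ⟨r t, ?_⟩
  simp only [r_mul_sr, inv_r, sr_mul_r, sr.injEq]
  linear_combination ht

variable {q : ℕ} [NeZero q] {M : Type*} [AddCommMonoid M] (f : DihedralGroup q → M)

theorem DihedralGroup.sum_eq : ∑ g, f g = ∑ i, f (r i) + ∑ i, f (sr i) := by
  refine Eq.trans ?_ (Fintype.sum_sum_type (fun x ↦ f (Sum.elim r sr x)))
  refine (Fintype.sum_bijective (Sum.elim r sr) ⟨?_, ?_⟩ _ _ fun _ ↦ rfl).symm
  · exact Function.Injective.sumElim (fun _ _ h ↦ r.inj h) (fun _ _ h ↦ sr.inj h)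
      fun _ _ h ↦ by cases h
  · rintro (i | i)
    exacts [⟨.inl i, rfl⟩, ⟨.inr i, rfl⟩]

theorem DihedralGroup.sum_zpowers_r_one [Fintype (Subgroup.zpowers (r (1 : ZMod q)))] :
    ∑ g : Subgroup.zpowers (r (1 : ZMod q)), f g = ∑ i, f (r i) := by
  refine (Fintype.sum_bijective (fun i ↦ (⟨r i, (i.cast : ℤ), by simp⟩ :
    Subgroup.zpowers (r (1 : ZMod q)))) ⟨?_, ?_⟩ (fun i ↦ f (r i)) (fun g ↦ f g) fun _ ↦ rfl).symm
  · exact fun _ _ h ↦ r.inj (congrArg Subtype.val h)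
  · rintro ⟨_, n, rfl⟩
    exact ⟨n, by simp⟩

theorem DihedralGroup.sum_zpowers_sr {q : ℕ} (f : DihedralGroup q → M) (i : ZMod q)
    [Fintype (Subgroup.zpowers (sr i))] :
    ∑ g : Subgroup.zpowers (sr i), f g = f 1 + f (sr i) := by
  classical
  have hne : (1 : Subgroup.zpowers (sr i)) ≠ ⟨sr i, Subgroup.mem_zpowers _⟩ :=
    fun h ↦ nomatch congrArg Subtype.val h
  have h : (Finset.univ : Finset (Subgroup.zpowers (sr i))) =
      {1, ⟨sr i, Subgroup.mem_zpowers _⟩} := by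
    refine (Finset.eq_univ_of_card _ ?_).symm
    rw [Finset.card_pair hne, ← Nat.card_eq_fintype_card,
      Nat.card_zpowers, orderOf_sr]
  rw [h, Finset.sum_pair hne]
  rfl

/-- If the dihedral group of order `2 * q`, with `q` odd, is a Galois group of `B` over `A`, with
intermediate rings `C` of invariants of the rotations and `D` of invariants of a reflection, then
the numbers of ring homomorphisms to a finite field satisfy the relation `B + 2 A = C + 2 D`. -/
theorem frobCount_dihedral {q : ℕ} [NeZero q] (hq : Odd q) {A B C D : Type*}
    [CommRing A] [CommRing B] [CommRing C] [CommRing D] [Module.Finite ℤ B]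
    [Algebra A B] [FaithfulSMul A B] [Algebra C B] [FaithfulSMul C B]
    [Algebra D B] [FaithfulSMul D B] [MulSemiringAction (DihedralGroup q) B]
    [IsGaloisGroup (DihedralGroup q) A B]
    [IsGaloisGroup (Subgroup.zpowers (r (1 : ZMod q))) C B]
    [IsGaloisGroup (Subgroup.zpowers (sr (0 : ZMod q))) D B] (p : ℕ) [Fact p.Prime] :
    frobCount B p + (frobCount A p + frobCount A p) =
      frobCount C p + (frobCount D p + frobCount D p) := by
  classical
  ext n
  simp only [ArithmeticFunction.add_apply]
  by_cases h : ∃ m, m ≠ 0 ∧ n = p ^ m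
  · obtain ⟨m, hm, rfl⟩ := h
    let a (g : DihedralGroup q) : ℕ :=
      Nat.card {x : B →+* AlgebraicClosure (ZMod p) // ∀ b, x b ^ p ^ m = x (g • b)}
    have hB : frobCount B p (p ^ m) = a 1 := by simp only [a, one_smul, frobCount_pow B p hm]
    have hA := card_mul_frobCount (A := A) (B := B) (G := DihedralGroup q) p hm
    have hC := card_mul_frobCount (A := C) (B := B) (G := Subgroup.zpowers (r (1 : ZMod q))) p hm
    have hD := card_mul_frobCount (A := D) (B := B) (G := Subgroup.zpowers (sr (0 : ZMod q))) p hm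
    have hsr (i : ZMod q) : a (sr i) = a (sr 0) := by
      obtain ⟨h, hh⟩ := isConj_iff.1 (isConj_sr hq 0 i)
      rw [← hh]
      exact card_ringHom_pow_eq_conj _ _ _
    change _ = ∑ g, a g at hA
    change _ = ∑ g : Subgroup.zpowers (r (1 : ZMod q)), a g at hC
    change _ = ∑ g : Subgroup.zpowers (sr (0 : ZMod q)), a g at hD
    rw [sum_eq, Finset.sum_congr rfl fun i _ ↦ hsr i, Finset.sum_const, Finset.card_univ,
      ZMod.card, nat_card, smul_eq_mul, ← sum_zpowers_r_one, ← hC] at hA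
    rw [sum_zpowers_sr, ← hB, Nat.card_zpowers, orderOf_sr] at hD
    rw [Nat.card_zpowers, orderOf_r_one] at hA
    have : 2 * frobCount A p (p ^ m) = frobCount C p (p ^ m) + a (sr 0) :=
      Nat.eq_of_mul_eq_mul_left (NeZero.pos q) (by linear_combination hA)
    omega
  · simp [frobCount_eq_zero _ h]

end dihedral

/-- The identity `ζ_B ζ_A ^ 2 = ζ_C ζ_D ^ 2` at the level of Dirichlet coefficients, for the
dihedral Galois group of order `2 * q`, with `q` odd, acting on `B`. -/
theorem idealCount_dihedral {q : ℕ} [NeZero q] (hq : Odd q) {A B C D : Type*}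
    [CommRing A] [IsDedekindDomain A] [Module.Free ℤ A] [Module.Finite ℤ A] [CharZero A]
    [CommRing B] [IsDedekindDomain B] [Module.Free ℤ B] [Module.Finite ℤ B] [CharZero B]
    [CommRing C] [IsDedekindDomain C] [Module.Free ℤ C] [Module.Finite ℤ C] [CharZero C]
    [CommRing D] [IsDedekindDomain D] [Module.Free ℤ D] [Module.Finite ℤ D] [CharZero D]
    [Algebra A B] [FaithfulSMul A B] [Algebra C B] [FaithfulSMul C B]
    [Algebra D B] [FaithfulSMul D B] [MulSemiringAction (DihedralGroup q) B]
    [IsGaloisGroup (DihedralGroup q) A B]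
    [IsGaloisGroup (Subgroup.zpowers (DihedralGroup.r (1 : ZMod q))) C B]
    [IsGaloisGroup (Subgroup.zpowers (DihedralGroup.sr (0 : ZMod q))) D B] :
    idealCount B * (idealCount A * idealCount A) =
      idealCount C * (idealCount D * idealCount D) := by
  refine ArithmeticFunction.eq_of_padicValArith_pmul_eq ?_ fun p hp ↦ ?_
  · simp [idealCount_one]
  · have : Fact p.Prime := ⟨hp⟩
    refine ⟨frobCount B p + (frobCount A p + frobCount A p), ?_, ?_, ?_⟩
    · simp [frobCount_one]
    · exact padicValArith_pmul_mul_eq padicValArith_pmul_idealCount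
        (padicValArith_pmul_mul_eq padicValArith_pmul_idealCount padicValArith_pmul_idealCount)
    · rw [frobCount_dihedral hq (C := C) (D := D)]
      exact padicValArith_pmul_mul_eq padicValArith_pmul_idealCount
        (padicValArith_pmul_mul_eq padicValArith_pmul_idealCount padicValArith_pmul_idealCount)

/-- If `G` acts on `F` through an isomorphism with the automorphism group of `F / K`, then a
subgroup `H` of `G` is a Galois group of `F` over the field fixed by the preimage of `H`. -/
theorem isGaloisGroup_of_eq_fixedField_comap {K F G : Type*} [Field K] [Field F] [Algebra K F]
    [Group G] [MulSemiringAction G F] [IsGaloisGroup G K F] (e : (F ≃ₐ[K] F) ≃* G)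
    (he : ∀ g x, e g • x = g x) {E : IntermediateField K F} (H : Subgroup G)
    (hE : E = IntermediateField.fixedField (H.comap e.toMonoidHom)) : IsGaloisGroup H E F := by
  refine IsGaloisGroup.of_fixedPoints_eq G K F H E (hE.symm ▸ ?_)
  ext x
  simp only [FixedPoints.mem_intermediateField_iff, IntermediateField.mem_fixedField_iff]
  refine ⟨fun h g hg ↦ ?_, fun h g ↦ ?_⟩
  · rw [← he]
    exact h ⟨e g, hg⟩
  · have := h (e.symm g) (by simp)
    rwa [← he, MulEquiv.apply_symm_apply] at this

theorem lseries_idealCount_mul_sq (M N : Type*) [Field M] [NumberField M] [Field N] [NumberField N]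
    {s : ℂ} (hs : 1 < s.re) :
    LSeries (fun n ↦ ((idealCount (𝓞 M) * (idealCount (𝓞 N) * idealCount (𝓞 N))) n : ℂ)) s =
      dedekindZetaFn M s * dedekindZetaFn N s ^ 2 := by
  have hM := lseriesSummable_idealCount M hs
  have hN := lseriesSummable_idealCount N hs
  simp only [← ArithmeticFunction.natCoe_apply, ArithmeticFunction.natCoe_mul] at hM hN ⊢
  rw [ArithmeticFunction.LSeries_mul' hM (ArithmeticFunction.LSeriesSummable_mul hN hN),
    ArithmeticFunction.LSeries_mul' hN hN, sq]
  simp only [ArithmeticFunction.natCoe_apply, lseries_idealCount _ hs]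

/-- Let `F/K` be a dihedral extension of number fields of degree `2q`, `q` odd,
with `L` the subfield fixed by the rotation subgroup and `k` the subfield fixed
by an order-2 subgroup.  Then for every `s ∈ ℂ` with `Re s > 1`,
`ζ_F(s)·ζ_K(s)² = ζ_L(s)·ζ_k(s)²`. -/
theorem dedekindZeta_dihedral (q : ℕ) [NeZero q] (hq : Odd q) (hq1 : 1 < q)
    (K F : Type*) [Field K] [NumberField K] [Field F] [NumberField F]
    [Algebra K F] [IsGalois K F]
    (e : (F ≃ₐ[K] F) ≃* DihedralGroup q)
    (Lf kf : IntermediateField K F) [NumberField Lf] [NumberField kf]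
    (hL : Lf = IntermediateField.fixedField
      ((Subgroup.zpowers (DihedralGroup.r (1 : ZMod q))).comap e.toMonoidHom))
    (hk : kf = IntermediateField.fixedField
      ((Subgroup.zpowers (DihedralGroup.sr (0 : ZMod q))).comap e.toMonoidHom))
    (s : ℂ) (hs : 1 < s.re) :
    dedekindZetaFn F s * dedekindZetaFn K s ^ 2
      = dedekindZetaFn Lf s * dedekindZetaFn kf s ^ 2 := by
  let _ : MulSemiringAction (DihedralGroup q) F :=
    MulSemiringAction.compHom F e.symm.toMonoidHom
  have he (g : F ≃ₐ[K] F) (x : F) : e g • x = g x :=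
    congrArg (fun h : F ≃ₐ[K] F ↦ h x) (e.symm_apply_apply g)
  have : IsGaloisGroup (DihedralGroup q) K F :=
    IsGaloisGroup.of_mulEquiv_algEquiv e.symm fun _ _ ↦ rfl
  have := isGaloisGroup_of_eq_fixedField_comap e he _ hL
  have := isGaloisGroup_of_eq_fixedField_comap e he _ hk
  have : IsGaloisGroup (Subgroup.zpowers (DihedralGroup.r (1 : ZMod q))) (𝓞 Lf) (𝓞 F) :=
    IsGaloisGroup.of_isFractionRing _ (𝓞 Lf) (𝓞 F) Lf F
  have : IsGaloisGroup (Subgroup.zpowers (DihedralGroup.sr (0 : ZMod q))) (𝓞 kf) (𝓞 F) :=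
    IsGaloisGroup.of_isFractionRing _ (𝓞 kf) (𝓞 F) kf F
  rw [← lseries_idealCount_mul_sq F K hs, ← lseries_idealCount_mul_sq Lf kf hs,
    idealCount_dihedral hq (A := 𝓞 K) (B := 𝓞 F) (C := 𝓞 Lf) (D := 𝓞 kf)]
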